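/- arXiv:cs/0110023 — 11 statements merged into one kernel-verified Lean document; each statement's English description precedes it below -/
import Mathlib

section
/- Let U be a type and A, B : Finset U, and let p, q be natural numbers. There exist finite sets Y : Fin p → Finset U and Z : Fin q → Finset U such that A ∪ (⋃_{i} Y i) = B ∪ (⋃_{j} Z j) (as Finsets) if and only if (p = 0 → B ⊆ A) and (q = 0 → A ⊆ B). In particular, when p ≥ 1 and q ≥ 1 a solution always exists. -/
/-- Assigning `B` to each of `p` set variables turns `A ∪ Y₁ ∪ ⋯ ∪ Y_p` into `A ∪ B`. -/
theorem union_biUnion_const_eq_union {U : Type*} [DecidableEq U] {A B : Finset U} {p : ℕ}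
    (h : p = 0 → B ⊆ A) :
    A ∪ (Finset.univ : Finset (Fin p)).biUnion (fun _ => B) = A ∪ B := by
  rcases p with _ | p
  · simpa using (Finset.union_eq_left.2 (h rfl)).symm
  · ext x
    simp

/-- A `gflat` set-unification problem `A ∪ Y₁ ∪ ⋯ ∪ Y_p = B ∪ Z₁ ∪ ⋯ ∪ Z_q` has a
solution iff `(p = 0 → B ⊆ A)` and `(q = 0 → A ⊆ B)`; in particular, when `p ≥ 1`
and `q ≥ 1` a solution always exists. -/
theorem gflat_unification_decidable (U : Type*) [DecidableEq U] (A B : Finset U) (p q : ℕ) :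
    ((∃ (Y : Fin p → Finset U) (Z : Fin q → Finset U),
        A ∪ Finset.univ.biUnion Y = B ∪ Finset.univ.biUnion Z) ↔
      ((p = 0 → B ⊆ A) ∧ (q = 0 → A ⊆ B))) ∧
    (1 ≤ p → 1 ≤ q → ∃ (Y : Fin p → Finset U) (Z : Fin q → Finset U),
        A ∪ Finset.univ.biUnion Y = B ∪ Finset.univ.biUnion Z) := by
  have solvable (hp : p = 0 → B ⊆ A) (hq : q = 0 → A ⊆ B) :
      ∃ (Y : Fin p → Finset U) (Z : Fin q → Finset U),
        A ∪ Finset.univ.biUnion Y = B ∪ Finset.univ.biUnion Z :=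
    ⟨fun _ => B, fun _ => A, by
      rw [union_biUnion_const_eq_union hp, union_biUnion_const_eq_union hq, Finset.union_comm]⟩
  refine ⟨⟨?_, fun h => solvable h.1 h.2⟩, fun hp hq => solvable (by omega) (by omega)⟩
  rintro ⟨Y, Z, h⟩
  constructor
  · rintro rfl
    have hA : A = B ∪ Finset.univ.biUnion Z := by simpa using h
    exact hA ▸ Finset.subset_union_left
  · rintro rfl
    have hB : A ∪ Finset.univ.biUnion Y = B := by simpa using h
    exact hB ▸ Finset.subset_union_left
end

section
/- Let U be a nonempty type and let C₁, C₂, C₃ : Finset U be pairwise disjoint. Let m₁, m₂, m₃ be natural numbers (the numbers of element variables occurring only on the left, only on the right, and on both sides, respectively). Assume the nondegeneracy condition: m₁ + m₃ + C₁.card + C₃.card = 0 if and only if m₂ + m₃ + C₂.card + C₃.card = 0. Then there exist functions σ₁ : Fin m₁ → U, σ₂ : Fin m₂ → U, σ₃ : Fin m₃ → U such that C₁ ∪ C₃ ∪ (image of σ₁) ∪ (image of σ₃) = C₂ ∪ C₃ ∪ (image of σ₂) ∪ (image of σ₃) (as Finsets) if and only if m₁ + m₂ + m₃ ≥ C₁.card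 + C₂.card, m₁ + m₃ ≥ C₂.card, and m₂ + m₃ ≥ C₁.card. -/
/-- A finite set `S` with at most `m` elements, inside a nonempty set `T`, is covered by the image
of some map from `Fin m` into `T`. -/
theorem Finset.exists_fin_map_subset_image_subset {U : Type*} [DecidableEq U] {S T : Finset U}
    {m : ℕ} (hST : S ⊆ T) (hT : T.Nonempty) (hm : S.card ≤ m) :
    ∃ σ : Fin m → U, S ⊆ Finset.image σ Finset.univ ∧ Finset.image σ Finset.univ ⊆ T := by
  obtain ⟨t, ht⟩ := hT
  refine ⟨fun i => if h : (i : ℕ) < S.card then (S.equivFin.symm ⟨i, h⟩ : U) else t, ?_, ?_⟩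
  · intro x hx
    refine Finset.mem_image.2 ⟨⟨S.equivFin ⟨x, hx⟩, (S.equivFin ⟨x, hx⟩).2.trans_le hm⟩,
      Finset.mem_univ _, ?_⟩
    simp
  · intro x hx
    obtain ⟨i, -, rfl⟩ := Finset.mem_image.1 hx
    split_ifs with h
    · exact hST (S.equivFin.symm ⟨i, h⟩).2
    · exact ht

/-- Decision criterion for `flat(0)` set unification. -/
theorem flat0_unification_decidable (U : Type*) [DecidableEq U] [Nonempty U]
    (C₁ C₂ C₃ : Finset U)
    (h12 : Disjoint C₁ C₂) (h13 : Disjoint C₁ C₃) (h23 : Disjoint C₂ C₃)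
    (m₁ m₂ m₃ : ℕ)
    (hnd : (m₁ + m₃ + C₁.card + C₃.card = 0) ↔ (m₂ + m₃ + C₂.card + C₃.card = 0)) :
    (∃ (σ₁ : Fin m₁ → U) (σ₂ : Fin m₂ → U) (σ₃ : Fin m₃ → U),
        C₁ ∪ C₃ ∪ Finset.image σ₁ Finset.univ ∪ Finset.image σ₃ Finset.univ =
        C₂ ∪ C₃ ∪ Finset.image σ₂ Finset.univ ∪ Finset.image σ₃ Finset.univ) ↔
      (C₁.card + C₂.card ≤ m₁ + m₂ + m₃ ∧ C₂.card ≤ m₁ + m₃ ∧ C₁.card ≤ m₂ + m₃) := by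
  have card_image_fin_le : ∀ {m : ℕ} (σ : Fin m → U), (Finset.image σ Finset.univ).card ≤ m :=
    fun σ => Finset.card_image_le.trans (by simp)
  constructor
  · rintro ⟨σ₁, σ₂, σ₃, h⟩
    have hc₁ := card_image_fin_le σ₁
    have hc₂ := card_image_fin_le σ₂
    have hc₃ := card_image_fin_le σ₃
    generalize Finset.image σ₁ Finset.univ = I₁ at *
    generalize Finset.image σ₂ Finset.univ = I₂ at *
    generalize Finset.image σ₃ Finset.univ = I₃ at *
    rw [Finset.disjoint_left] at h13 h23
    have d12 := Finset.disjoint_left.1 h12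
    have h₂ : C₂ ⊆ I₁ ∪ I₃ := by
      intro x hx
      have := Finset.ext_iff.1 h x
      simp only [Finset.mem_union] at this ⊢
      have := @d12 x
      have := @h23 x
      tauto
    have h₁ : C₁ ⊆ I₂ ∪ I₃ := by
      intro x hx
      have := Finset.ext_iff.1 h x
      simp only [Finset.mem_union] at this ⊢
      have := @d12 x
      have := @h13 x
      tauto
    have h₁₂ : C₁ ∪ C₂ ⊆ I₁ ∪ I₂ ∪ I₃ := by
      refine Finset.union_subset (h₁.trans ?_) (h₂.trans ?_) <;> intro x <;>
        simp only [Finset.mem_union] <;> tauto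
    have k₁ := Finset.card_le_card h₁
    have k₂ := Finset.card_le_card h₂
    have k₁₂ := Finset.card_le_card h₁₂
    rw [Finset.card_union_of_disjoint h12] at k₁₂
    have := Finset.card_union_le I₂ I₃
    have := Finset.card_union_le I₁ I₃
    have := Finset.card_union_le (I₁ ∪ I₂) I₃
    have := Finset.card_union_le I₁ I₂
    omega
  · rintro ⟨h₁₂, h₂, h₁⟩
    rcases (C₁ ∪ C₂ ∪ C₃).eq_empty_or_nonempty with hT | hT
    · obtain ⟨u⟩ := ‹Nonempty U›
      simp only [Finset.union_eq_empty] at hT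
      obtain ⟨⟨rfl, rfl⟩, rfl⟩ := hT
      refine ⟨fun _ => u, fun _ => u, fun _ => u, ?_⟩
      ext x
      rcases m₁ with _ | m₁ <;> rcases m₂ with _ | m₂ <;> rcases m₃ with _ | m₃ <;>
        simp_all
    · obtain ⟨A, hA, hAc⟩ := Finset.exists_subset_card_eq (Nat.sub_le C₁.card m₂)
      obtain ⟨B, hB, hBc⟩ := Finset.exists_subset_card_eq (Nat.sub_le C₂.card m₁)
      have hAB := Finset.card_union_le A B
      have hcA := Finset.card_sdiff_of_subset hA
      have hcB := Finset.card_sdiff_of_subset hB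
      have sub₁ : C₁ ⊆ C₁ ∪ C₂ ∪ C₃ := fun x hx => by simp [hx]
      have sub₂ : C₂ ⊆ C₁ ∪ C₂ ∪ C₃ := fun x hx => by simp [hx]
      obtain ⟨σ₁, l₁, u₁⟩ := Finset.exists_fin_map_subset_image_subset (m := m₁)
        (Finset.sdiff_subset.trans sub₂ : C₂ \ B ⊆ _) hT (by omega)
      obtain ⟨σ₂, l₂, u₂⟩ := Finset.exists_fin_map_subset_image_subset (m := m₂)
        (Finset.sdiff_subset.trans sub₁ : C₁ \ A ⊆ _) hT (by omega)
      obtain ⟨σ₃, l₃, u₃⟩ := Finset.exists_fin_map_subset_image_subset (m := m₃)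
        (Finset.union_subset (hA.trans sub₁) (hB.trans sub₂)) hT (by omega)
      refine ⟨σ₁, σ₂, σ₃, ?_⟩
      generalize Finset.image σ₁ Finset.univ = I₁ at *
      generalize Finset.image σ₂ Finset.univ = I₂ at *
      generalize Finset.image σ₃ Finset.univ = I₃ at *
      ext x
      have l₁ := @l₁ x
      have l₂ := @l₂ x
      have l₃ := @l₃ x
      have u₁ := @u₁ x
      have u₂ := @u₂ x
      have u₃ := @u₃ x
      simp only [Finset.mem_union, Finset.mem_sdiff] at *
      grind
end

section
/- Let U be a nonempty type, let C₁, C₂, C₃ : Finset U be pairwise disjoint, let m₁, m₂, m₃ be natural numbers, and let q ≥ 1. Assume m₁ = 0 or m₂ + m₃ + C₂.card + C₃.card ≥ 1. Then there exist σ₁ : Fin m₁ → U, σ₂ : Fin m₂ → U, σ₃ : Fin m₃ → U and Y : Fin q → Finset U such that C₁ ∪ C₃ ∪ (image of σ₁) ∪ (image of σ₃) ∪ (⋃_{i} Y i) = C₂ ∪ C₃ ∪ (image of σ₂) ∪ (image of σ₃) (as Finsets) if and only if m₂ + m₃ ≥ C₁.card. -/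
/-- A finset with at most as many elements as a finite type is covered by the image of a map
from that type. -/
theorem Finset.exists_subset_image_univ_of_card_le {α U : Type*} [Fintype α] [DecidableEq U]
    [Nonempty U] (C : Finset U) (h : C.card ≤ Fintype.card α) :
    ∃ f : α → U, C ⊆ Finset.image f Finset.univ := by
  obtain ⟨e⟩ : Nonempty (C ↪ α) := Function.Embedding.nonempty_of_card_le (by simpa using h)
  refine ⟨Function.extend e Subtype.val fun _ => Classical.arbitrary U, fun x hx => ?_⟩
  exact Finset.mem_image.2 ⟨e ⟨x, hx⟩, Finset.mem_univ _, e.injective.extend_apply _ _ _⟩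

/-- Decision criterion for `flat(q)` set unification with set variables on one side only. -/
theorem flatq_one_sided_unification_decidable (U : Type*) [DecidableEq U] [Nonempty U]
    (C₁ C₂ C₃ : Finset U)
    (h12 : Disjoint C₁ C₂) (h13 : Disjoint C₁ C₃) (h23 : Disjoint C₂ C₃)
    (m₁ m₂ m₃ q : ℕ) (hq : 1 ≤ q)
    (hdeg : m₁ = 0 ∨ 1 ≤ m₂ + m₃ + C₂.card + C₃.card) :
    (∃ (σ₁ : Fin m₁ → U) (σ₂ : Fin m₂ → U) (σ₃ : Fin m₃ → U) (Y : Fin q → Finset U),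
        C₁ ∪ C₃ ∪ Finset.image σ₁ Finset.univ ∪ Finset.image σ₃ Finset.univ ∪
          Finset.univ.biUnion Y =
        C₂ ∪ C₃ ∪ Finset.image σ₂ Finset.univ ∪ Finset.image σ₃ Finset.univ) ↔
      C₁.card ≤ m₂ + m₃ := by
  constructor
  · rintro ⟨σ₁, σ₂, σ₃, Y, h⟩
    have hsub : C₁ ⊆ Finset.image σ₂ Finset.univ ∪ Finset.image σ₃ Finset.univ := by
      intro x hx
      have hx2 := Finset.disjoint_left.1 h12 hx
      have hx3 := Finset.disjoint_left.1 h13 hx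
      have hR : x ∈ C₂ ∪ C₃ ∪ Finset.image σ₂ Finset.univ ∪ Finset.image σ₃ Finset.univ := by
        rw [← h]
        simp only [Finset.mem_union, hx, true_or]
      simpa only [Finset.mem_union, hx2, hx3, false_or] using hR
    calc C₁.card ≤ _ := Finset.card_le_card hsub
      _ ≤ _ := Finset.card_union_le _ _
      _ ≤ m₂ + m₃ := add_le_add (Finset.card_image_le.trans_eq (Finset.card_fin m₂))
          (Finset.card_image_le.trans_eq (Finset.card_fin m₃))
  · intro h
    obtain ⟨f, hf⟩ := C₁.exists_subset_image_univ_of_card_le (α := Fin m₂ ⊕ Fin m₃)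
      (by simpa using h)
    set R := C₂ ∪ C₃ ∪ Finset.image (f ∘ Sum.inl) Finset.univ ∪
      Finset.image (f ∘ Sum.inr) Finset.univ with hR
    have hC₁ : C₁ ⊆ R := by
      intro x hx
      obtain ⟨a | b, -, rfl⟩ := Finset.mem_image.1 (hf hx) <;> simp [hR]
    have hσ₁ : ∃ σ₁ : Fin m₁ → U, Finset.image σ₁ Finset.univ ⊆ R := by
      rcases hdeg with rfl | hdeg
      · exact ⟨Fin.elim0, by simp⟩
      · obtain ⟨r, hr⟩ : R.Nonempty := by
          rw [Finset.nonempty_iff_ne_empty]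
          intro hempty
          simp only [hR, Finset.union_eq_empty, Finset.image_eq_empty,
            Finset.univ_eq_empty_iff] at hempty
          obtain ⟨⟨⟨rfl, rfl⟩, h₂⟩, h₃⟩ := hempty
          rw [← Fintype.card_eq_zero_iff, Fintype.card_fin] at h₂ h₃
          simp [h₂, h₃] at hdeg
        exact ⟨fun _ => r, Finset.image_subset_iff.2 fun _ _ => hr⟩
    obtain ⟨σ₁, hσ₁⟩ := hσ₁
    refine ⟨σ₁, f ∘ Sum.inl, f ∘ Sum.inr, fun _ => R, ?_⟩
    rw [← hR]
    apply Finset.Subset.antisymm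
    · refine Finset.union_subset (Finset.union_subset (Finset.union_subset
        (Finset.union_subset hC₁ ?_) hσ₁) ?_) (Finset.biUnion_subset.2 fun _ _ => subset_rfl)
      · intro x hx
        simp only [hR, Finset.mem_union, hx, true_or, or_true]
      · exact Finset.subset_union_right
    · exact (Finset.subset_biUnion_of_mem (fun _ : Fin q => R)
        (Finset.mem_univ ⟨0, hq⟩)).trans Finset.subset_union_right
end

section
/- Let U be a type, B, C : Finset U disjoint with B.card = k, and h : ℕ. Assume (B ∪ C) is nonempty or h = 0. Then there exists f : Fin h → U with C ∪ (Finset.image f Finset.univ) = B ∪ C if and only if k ≤ h. -/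
/-- Decision criterion for bound simple set matching: a solution exists iff `k ≤ h`. -/
theorem bound_simple_matching_decidable (U : Type*) [DecidableEq U]
    (B C : Finset U) (hdisj : Disjoint B C) (k h : ℕ) (hB : B.card = k)
    (hne : (B ∪ C).Nonempty ∨ h = 0) :
    (∃ f : Fin h → U, C ∪ Finset.image f Finset.univ = B ∪ C) ↔ k ≤ h := by
  constructor
  · rintro ⟨f, hf⟩
    have hsub : B ⊆ Finset.image f Finset.univ := fun x hx =>
      (Finset.mem_union.1 (hf.symm ▸ Finset.mem_union_left C hx)).resolve_left
        (Finset.disjoint_left.1 hdisj hx)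
    calc k = B.card := hB.symm
      _ ≤ (Finset.image f Finset.univ).card := Finset.card_le_card hsub
      _ ≤ (Finset.univ : Finset (Fin h)).card := Finset.card_image_le
      _ = h := Finset.card_fin h
  · intro hk
    rcases hne with ⟨u, hu⟩ | rfl
    · let e := B.equivFinOfCardEq hB
      let f : Fin h → U := fun i => if hi : i.1 < k then (e.symm ⟨i, hi⟩ : U) else u
      have hf_mem (i : Fin h) : f i ∈ B ∪ C := by
        by_cases hi : i.1 < k
        · simp [f, hi]
        · simpa [f, hi] using hu
      have hf_surj (x : U) (hx : x ∈ B) : ∃ i, f i = x :=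
        ⟨Fin.castLE hk (e ⟨x, hx⟩), by simp [f]⟩
      refine ⟨f, Finset.Subset.antisymm ?_ ?_⟩
      · refine Finset.union_subset Finset.subset_union_right ?_
        exact Finset.image_subset_iff.2 fun i _ => hf_mem i
      · refine Finset.union_subset (fun x hx => ?_) Finset.subset_union_left
        obtain ⟨i, rfl⟩ := hf_surj x hx
        exact Finset.mem_union_right C (Finset.mem_image_of_mem f (Finset.mem_univ i))
    · have hB_empty : B = ∅ := Finset.card_eq_zero.1 (by omega)
      exact ⟨Fin.elim0, by simp [hB_empty]⟩
end

section
/- Let n : ℕ and let φ be a 3CNF formula given as a finite list of clauses, each clause being a triple of literals, where a literal is a pair (i, b) : Fin n × Bool (b = true for a positive occurrence of variable i, b = false for a negative one). Define, for functions X Y : Fin n → ZFSet, the value of a literal by v(i, true) = X i and v(i, false) = Y i. Then φ is satisfiable (i.e., there is τ : Fin n → Bool such that every clause contains a literal (i, b) with τ i = b) if and only if there exist X Y : Fin n → ZFSet such that for all i the ZFSet {X i, Y i} equals {∅, {∅}}, and for every clause with literals ℓ₁, ℓ₂, ℓ₃ the ZFSet {v ℓ₁, v ℓ₂, v ℓ₃,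 ∅} equals {∅, {∅}}. -/
namespace ZFSet

theorem insert_pair_eq_insert_pair_iff {x y a b : ZFSet} :
    ({x, y} : ZFSet) = {a, b} ↔ x = a ∧ y = b ∨ x = b ∧ y = a := by
  constructor
  · intro h
    have hmem (w : ZFSet) : (w = x ∨ w = y) ↔ (w = a ∨ w = b) := by
      rw [← mem_pair, ← mem_pair, h]
    have := hmem x
    have := hmem y
    have := hmem a
    have := hmem b
    grind
  · rintro (⟨rfl, rfl⟩ | ⟨rfl, rfl⟩)
    · rfl
    · ext w
      simp only [mem_pair, or_comm]

theorem insert_triple_eq_pair_iff {x y z a b : ZFSet} (hab : a ≠ b) :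
    ({x, y, z, a} : ZFSet) = {a, b} ↔
      ((x = a ∨ x = b) ∧ (y = a ∨ y = b) ∧ (z = a ∨ z = b)) ∧ (x = b ∨ y = b ∨ z = b) := by
  simp only [ZFSet.ext_iff (x := {x, y, z, a}), mem_insert_iff, mem_singleton]
  constructor
  · intro hmem
    have := hmem x
    have := hmem y
    have := hmem z
    have := hmem b
    grind
  · grind

theorem empty_ne_singleton (x : ZFSet) : (∅ : ZFSet) ≠ {x} := fun h =>
  notMem_empty x (h ▸ mem_singleton.mpr rfl)

end ZFSet

/-- Correctness of the reduction of 3SAT to unification of nested set terms: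
`φ` is satisfiable iff the corresponding system of set equations over `ZFSet`
(interpreting `∅` as false and `{∅}` as true) has a solution. -/
theorem threeSat_reduces_to_nested_set_unification (n : ℕ)
    (φ : List ((Fin n × Bool) × (Fin n × Bool) × (Fin n × Bool))) :
    (∃ τ : Fin n → Bool, ∀ c ∈ φ,
        τ c.1.1 = c.1.2 ∨ τ c.2.1.1 = c.2.1.2 ∨ τ c.2.2.1 = c.2.2.2) ↔
    (∃ X Y : Fin n → ZFSet,
        (∀ i, ({X i, Y i} : ZFSet) = {∅, {∅}}) ∧
        (∀ c ∈ φ,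
          (let v : Fin n × Bool → ZFSet := fun l => if l.2 then X l.1 else Y l.1
           ({v c.1, v c.2.1, v c.2.2, ∅} : ZFSet) = {∅, {∅}}))) := by
  simp only [ZFSet.insert_pair_eq_insert_pair_iff,
    ZFSet.insert_triple_eq_pair_iff (ZFSet.empty_ne_singleton ∅)]
  constructor
  · rintro ⟨τ, hτ⟩
    refine ⟨fun i => if τ i then {∅} else ∅, fun i => if τ i then ∅ else {∅}, ?_, ?_⟩
    · grind
    · intro c hc
      have hclause := hτ c hc
      grind
  · classical
    rintro ⟨X, Y, hXY, hclauses⟩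
    refine ⟨fun i => decide (X i = {∅}), fun c hc => ?_⟩
    have htrue (l : Fin n × Bool) (hl : (if l.2 then X l.1 else Y l.1) = {∅}) :
        decide (X l.1 = {∅}) = l.2 := by
      have := hXY l.1
      grind [ZFSet.empty_ne_singleton]
    exact (hclauses c hc).2.imp (htrue _) (Or.imp (htrue _) (htrue _))
end

section
/- Let U be a type and u₀, u₁ : U with u₀ ≠ u₁. Let n : ℕ and let φ be a 3CNF formula given as a finite list of clauses, each clause being a triple of literals, where a literal is a pair (i, b) : Fin n × Bool. Define, for functions x y : Fin n → U, the value of a literal by v(i, true) = x i and v(i, false) = y i. Then φ is satisfiable (i.e., there is τ : Fin n → Bool such that every clause contains a literal (i, b) with τ i = b) if and only if there exist x y : Fin n → U such that for all i the Finset {x i, y i} equals {u₀, u₁}, and for every clause with literals ℓ₁, ℓ₂, ℓ₃ the Finset {v ℓ₁, v ℓ₂, v ℓ₃, u₀} equals {u₀, u₁}. -/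
/-- A clause equation forces every literal value to be a truth value, and one of them to be `u₁`. -/
theorem clause_equation_iff {U : Type*} [DecidableEq U] {u₀ u₁ a b c : U} (hne : u₀ ≠ u₁) :
    ({a, b, c, u₀} : Finset U) = {u₀, u₁} ↔
      (a = u₀ ∨ a = u₁) ∧ (b = u₀ ∨ b = u₁) ∧ (c = u₀ ∨ c = u₁) ∧
        (a = u₁ ∨ b = u₁ ∨ c = u₁) := by
  constructor
  · intro h
    simp only [Finset.ext_iff, Finset.mem_insert, Finset.mem_singleton] at h
    have ha := h a
    have hb := h b
    have hc := h c
    have h₁ := h u₁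
    grind
  · intro h
    ext z
    simp only [Finset.mem_insert, Finset.mem_singleton]
    grind

/-- A pair equation says that the two entries are complementary truth values. -/
theorem pair_equation_iff {U : Type*} [DecidableEq U] {u₀ u₁ a b : U} :
    ({a, b} : Finset U) = {u₀, u₁} ↔ (a = u₀ ∧ b = u₁) ∨ (a = u₁ ∧ b = u₀) := by
  rw [← Finset.coe_inj]
  simp only [Finset.coe_insert, Finset.coe_singleton]
  exact Set.pair_eq_pair_iff

/-- Correctness of the reduction of 3SAT to a system of equations between flat
set terms (interpreting `u₀` as false and `u₁` as true). -/
theorem threeSat_reduces_to_flat_set_unification_system (U : Type*) [DecidableEq U]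
    (u₀ u₁ : U) (hne : u₀ ≠ u₁) (n : ℕ)
    (φ : List ((Fin n × Bool) × (Fin n × Bool) × (Fin n × Bool))) :
    (∃ τ : Fin n → Bool, ∀ c ∈ φ,
        τ c.1.1 = c.1.2 ∨ τ c.2.1.1 = c.2.1.2 ∨ τ c.2.2.1 = c.2.2.2) ↔
    (∃ x y : Fin n → U,
        (∀ i, ({x i, y i} : Finset U) = {u₀, u₁}) ∧
        (∀ c ∈ φ,
          (let v : Fin n × Bool → U := fun l => if l.2 then x l.1 else y l.1
           ({v c.1, v c.2.1, v c.2.2, u₀} : Finset U) = {u₀, u₁}))) := by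
  simp only [pair_equation_iff, clause_equation_iff hne]
  constructor
  · rintro ⟨τ, hτ⟩
    refine ⟨fun i => if τ i then u₁ else u₀, fun i => if τ i then u₀ else u₁, ?_, ?_⟩
    · intro i
      by_cases h : τ i <;> simp [h]
    · intro c hc
      have := hτ c hc
      grind
  · rintro ⟨x, y, hxy, hφ⟩
    have literal_true (l : Fin n × Bool) (hl : (if l.2 then x l.1 else y l.1) = u₁) :
        decide (x l.1 = u₁) = l.2 := by
      have := hxy l.1
      grind
    refine ⟨fun i => decide (x i = u₁), fun c hc => ?_⟩
    obtain ⟨-, -, -, h⟩ := hφ c hc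
    exact h.imp (literal_true _) (Or.imp (literal_true _) (literal_true _))
end

section
/- For every type α, all elements y₁ y₂ : α, and all sets v₁ v₂ : Set α: insert y₁ v₁ = insert y₂ v₂ if and only if (y₁ = y₂ ∧ v₁ = v₂) ∨ (y₁ = y₂ ∧ v₁ = insert y₂ v₂) ∨ (y₁ = y₂ ∧ insert y₁ v₁ = v₂) ∨ (∃ k : Set α, v₁ = insert y₂ k ∧ v₂ = insert y₁ k). -/
/-- If inserting distinct elements gives the same set, the first set is recovered from the
intersection by inserting the second element. -/
theorem Set.eq_insert_inter_of_insert_eq_insert {α : Type*} {a b : α} {s t : Set α}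
    (hab : a ≠ b) (h : insert a s = insert b t) : s = insert b (s ∩ t) := by
  have hb : b ∈ s :=
    Set.mem_of_mem_insert_of_ne (h ▸ Set.mem_insert b t) hab.symm
  refine Set.Subset.antisymm (fun x hx => ?_)
    (Set.insert_subset hb Set.inter_subset_left)
  have hx' : x ∈ insert b t := h ▸ Set.mem_insert_of_mem a hx
  exact hx'.imp id fun hxt => ⟨hx, hxt⟩

/-- The axiom `(Eˢₖ)`: a syntactic version of extensionality for sets built
by element insertion. -/
theorem insert_eq_insert_iff (α : Type*) (y₁ y₂ : α) (v₁ v₂ : Set α) :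
    insert y₁ v₁ = insert y₂ v₂ ↔
      (y₁ = y₂ ∧ v₁ = v₂) ∨
      (y₁ = y₂ ∧ v₁ = insert y₂ v₂) ∨
      (y₁ = y₂ ∧ insert y₁ v₁ = v₂) ∨
      (∃ k : Set α, v₁ = insert y₂ k ∧ v₂ = insert y₁ k) := by
  constructor
  · intro h
    by_cases hy : y₁ = y₂
    · subst hy
      by_cases h₁ : y₁ ∈ v₁
      · exact .inr (.inl ⟨rfl, by rw [← h, Set.insert_eq_of_mem h₁]⟩)
      by_cases h₂ : y₁ ∈ v₂
      · exact .inr (.inr (.inl ⟨rfl, by rw [h, Set.insert_eq_of_mem h₂]⟩))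
      · refine .inl ⟨rfl, ?_⟩
        rw [← Set.insert_sdiff_self_of_notMem h₁, h, Set.insert_sdiff_self_of_notMem h₂]
    · refine .inr (.inr (.inr ⟨v₁ ∩ v₂, Set.eq_insert_inter_of_insert_eq_insert hy h, ?_⟩))
      rw [Set.inter_comm]
      exact Set.eq_insert_inter_of_insert_eq_insert (Ne.symm hy) h.symm
  · rintro (⟨rfl, rfl⟩ | ⟨rfl, rfl⟩ | ⟨rfl, rfl⟩ | ⟨k, rfl, rfl⟩)
    · rfl
    · exact Set.insert_idem _ _
    · exact (Set.insert_idem _ _).symm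
    · exact Set.insert_comm _ _ _
end

section
/- For all x y : PSet, PSet.Equiv x y holds if and only if there exists a relation R : PSet → PSet → Prop such that R x y and R is a bisimulation, i.e., for all a b : PSet with R a b: for every u ∈ a there exists v ∈ b with R u v, and for every v ∈ b there exists u ∈ a with R u v. -/
/-- Extensional equivalence of pre-sets is itself a bisimulation. -/
theorem PSet.Equiv.bisimulation {a b : PSet} (h : PSet.Equiv a b) :
    (∀ u ∈ a, ∃ v ∈ b, PSet.Equiv u v) ∧ (∀ v ∈ b, ∃ u ∈ a, PSet.Equiv u v) := by
  constructor
  · rintro u ⟨i, hi⟩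
    obtain ⟨j, hj⟩ := h.exists_left i
    exact ⟨b.Func j, b.func_mem j, hi.trans hj⟩
  · rintro v ⟨j, hj⟩
    obtain ⟨i, hi⟩ := h.exists_right j
    exact ⟨a.Func i, a.func_mem i, hi.trans hj.symm⟩

/-- Every bisimulation is contained in extensional equivalence. -/
theorem PSet.equiv_of_bisimulation {R : PSet → PSet → Prop}
    (hR : ∀ a b : PSet, R a b → (∀ u ∈ a, ∃ v ∈ b, R u v) ∧ (∀ v ∈ b, ∃ u ∈ a, R u v))
    {a b : PSet} (hab : R a b) : PSet.Equiv a b := by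
  induction a using PSet.mem_wf.induction generalizing b with
  | _ a ih =>
    refine PSet.equiv_iff.2 ⟨fun i => ?_, fun j => ?_⟩
    · obtain ⟨v, ⟨j, hj⟩, hv⟩ := (hR a b hab).1 _ (a.func_mem i)
      exact ⟨j, (ih _ (a.func_mem i) hv).trans hj⟩
    · obtain ⟨u, hu, huv⟩ := (hR a b hab).2 _ (b.func_mem j)
      have ⟨i, hi⟩ := hu
      exact ⟨i, hi.symm.trans (ih u hu huv)⟩

/-- Two well-founded sets (pre-sets) are extensionally equivalent iff their tree
representations are bisimilar. -/
theorem pset_equiv_iff_bisimulation (x y : PSet) :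
    PSet.Equiv x y ↔
      ∃ R : PSet → PSet → Prop, R x y ∧
        ∀ a b : PSet, R a b →
          (∀ u ∈ a, ∃ v ∈ b, R u v) ∧ (∀ v ∈ b, ∃ u ∈ a, R u v) :=
  ⟨fun h => ⟨PSet.Equiv, h, fun _ _ hab => hab.bisimulation⟩,
    fun ⟨_, hxy, hR⟩ => PSet.equiv_of_bisimulation hR hxy⟩
end

section
/- Let V be a finite type, let E₁, E₀ : Finset (V × V), and let Z : Finset V. Call σ : V → ℕ consistent if σ y = σ x + 1 for every (x, y) ∈ E₁, σ x ≤ σ y for every (x, y) ∈ E₀, and σ x = 0 for every x ∈ Z. If a consistent labeling exists, then there exists a consistent labeling σ with σ v ≤ E₁.card for every v : V. -/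
/-- If a labeled graph with `+1`-edges `E₁`, `0`-edges `E₀` and zero-forced nodes `Z`
admits a consistent labeling, then it admits one bounded by the number of `+1`-edges. -/
theorem consistent_labeling_bounded (V : Type*) [Fintype V] [DecidableEq V]
    (E₁ E₀ : Finset (V × V)) (Z : Finset V)
    (hex : ∃ σ : V → ℕ,
      (∀ e ∈ E₁, σ e.2 = σ e.1 + 1) ∧ (∀ e ∈ E₀, σ e.1 ≤ σ e.2) ∧ (∀ x ∈ Z, σ x = 0)) :
    ∃ σ : V → ℕ,
      ((∀ e ∈ E₁, σ e.2 = σ e.1 + 1) ∧ (∀ e ∈ E₀, σ e.1 ≤ σ e.2) ∧ (∀ x ∈ Z, σ x = 0)) ∧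
      ∀ v : V, σ v ≤ E₁.card := by
  obtain ⟨σ, h₁, h₀, hZ⟩ := hex
  -- Keep only the levels from which some `+1`-edge starts, and collapse all the others.
  let L : Finset ℕ := E₁.image fun e => σ e.1
  refine ⟨fun v => (L.filter (· < σ v)).card, ⟨fun e he => ?_, fun e he => ?_, fun x hx => ?_⟩,
    fun v => (Finset.card_filter_le _ _).trans Finset.card_image_le⟩
  · have hL : σ e.1 ∈ L := Finset.mem_image_of_mem (fun e => σ e.1) he
    have hins : L.filter (· < σ e.2) = insert (σ e.1) (L.filter (· < σ e.1)) := by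
      ext l
      have := h₁ e he
      grind
    simp [hins]
  · exact Finset.card_le_card
      (Finset.monotone_filter_right L fun _ _ hl => hl.trans_le (h₀ e he))
  · simp [hZ x hx]
end

section
/- Let V be a finite type and consider a finite system of integer constraints over variables V given by Finsets E_eq, E_le, E_succ : Finset (V × V) and Z₀, Z₁ : Finset V, where a function σ : V → ℕ is a solution if σ x = σ y for every (x, y) ∈ E_eq, σ x ≤ σ y for every (x, y) ∈ E_le, σ x = σ y + 1 for every (x, y) ∈ E_succ, σ x = 0 for every x ∈ Z₀, and σ x = 1 for every x ∈ Z₁. Let p = E_succ.card + Z₁.card. If the system has a solution, then it has a solution σ with σ v ≤ p for every v : V. -/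
/-- The number of elements of `L` that are at most `n`. -/
def countLE (L : Finset ℕ) (n : ℕ) : ℕ := (L.filter (· ≤ n)).card

theorem countLE_mono (L : Finset ℕ) : Monotone (countLE L) := fun _ _ h =>
  Finset.card_le_card (Finset.monotone_filter_right L fun _ _ hk => le_trans hk h)

theorem countLE_le_card (L : Finset ℕ) (n : ℕ) : countLE L n ≤ L.card :=
  Finset.card_filter_le _ _

theorem countLE_succ {L : Finset ℕ} {n : ℕ} (h : n + 1 ∈ L) :
    countLE L (n + 1) = countLE L n + 1 := by
  have hins : L.filter (· ≤ n + 1) = insert (n + 1) (L.filter (· ≤ n)) := by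
    ext k
    simp only [Finset.mem_filter, Finset.mem_insert]
    grind
  rw [countLE, hins, Finset.card_insert_of_notMem (by simp), countLE]

theorem countLE_zero {L : Finset ℕ} (h : 0 ∉ L) : countLE L 0 = 0 := by
  simpa [countLE, Finset.filter_eq_empty_iff] using fun k hk (h0 : k = 0) => h (h0 ▸ hk)

/-- Arithmetic core of the level lemma: a satisfiable system of integer constraints
of the forms `x = y`, `x ≤ y`, `x = y + 1`, `x = 0`, `x = 1` has a solution bounded
by `p`, the number of constraints of the forms `x = y + 1` and `x = 1`. -/
theorem level_lemma_bounded_solution (V : Type*) [Fintype V] [DecidableEq V]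
    (E_eq E_le E_succ : Finset (V × V)) (Z₀ Z₁ : Finset V)
    (hex : ∃ σ : V → ℕ,
      (∀ e ∈ E_eq, σ e.1 = σ e.2) ∧ (∀ e ∈ E_le, σ e.1 ≤ σ e.2) ∧
      (∀ e ∈ E_succ, σ e.1 = σ e.2 + 1) ∧ (∀ x ∈ Z₀, σ x = 0) ∧ (∀ x ∈ Z₁, σ x = 1)) :
    ∃ σ : V → ℕ,
      ((∀ e ∈ E_eq, σ e.1 = σ e.2) ∧ (∀ e ∈ E_le, σ e.1 ≤ σ e.2) ∧
       (∀ e ∈ E_succ, σ e.1 = σ e.2 + 1) ∧ (∀ x ∈ Z₀, σ x = 0) ∧ (∀ x ∈ Z₁, σ x = 1)) ∧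
      ∀ v : V, σ v ≤ E_succ.card + Z₁.card := by
  obtain ⟨σ, heq, hle, hsucc, hzero, hone⟩ := hex
  -- Collapse the levels of `σ` that are forced neither by `x = y + 1` nor by `x = 1`.
  let L : Finset ℕ := E_succ.image (fun e => σ e.1) ∪ Z₁.image σ
  have h0 : 0 ∉ L := by
    simp only [L, Finset.mem_union, Finset.mem_image]
    rintro (⟨e, he, h⟩ | ⟨x, hx, h⟩)
    · have := hsucc e he
      omega
    · have := hone x hx
      omega
  refine ⟨fun v => countLE L (σ v), ⟨fun e he => congrArg _ (heq e he),
    fun e he => countLE_mono L (hle e he), fun e he => ?_, fun x hx => ?_, fun x hx => ?_⟩,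
    fun v => (countLE_le_card L _).trans ?_⟩
  · have hmem : σ e.2 + 1 ∈ L :=
      hsucc e he ▸ Finset.mem_union_left _ (Finset.mem_image_of_mem (fun e => σ e.1) he)
    simpa only [hsucc e he] using countLE_succ hmem
  · simpa only [hzero x hx] using countLE_zero h0
  · have hmem : 1 ∈ L :=
      hone x hx ▸ Finset.mem_union_right _ (Finset.mem_image_of_mem σ hx)
    simpa only [hone x hx, countLE_zero h0] using countLE_succ (n := 0) hmem
  · exact (Finset.card_union_le _ _).trans
      (Nat.add_le_add Finset.card_image_le Finset.card_image_le)
end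

section
/- Let U be a type and n, m, p : ℕ, and let S : Fin n → Finset U, T : Fin m → Finset U, X : Fin p → Finset U. Then (⋃_{j} S j) ∪ (⋃_{k} X k) = (⋃_{i} T i) ∪ (⋃_{k} X k) (as Finsets) if and only if there exist families A : Fin m → Fin n → Finset U, B : Fin m → Fin p → Finset U, C : Fin p → Fin n → Finset U, and D : Fin p → Finset U such that: S j = (⋃_{i} A i j) ∪ (⋃_{k} C k j) for every j; T i = (⋃_{j} A i j) ∪ (⋃_{k} B i k) for every i; and X k = (⋃_{i} B i k) ∪ (⋃_{j} C k j) ∪ D k for every k. -/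
/-- The elementary `ACI`-matrix parametrization is a most general solution of the
elementary `ACI1` unification problem
`S₁ ∪ ⋯ ∪ Sₙ ∪ X₁ ∪ ⋯ ∪ X_p = T₁ ∪ ⋯ ∪ T_m ∪ X₁ ∪ ⋯ ∪ X_p`. -/
theorem elementary_aci_matrix_mgu (U : Type*) [DecidableEq U] (n m p : ℕ)
    (S : Fin n → Finset U) (T : Fin m → Finset U) (X : Fin p → Finset U) :
    (Finset.univ.biUnion S ∪ Finset.univ.biUnion X =
     Finset.univ.biUnion T ∪ Finset.univ.biUnion X) ↔
    ∃ (A : Fin m → Fin n → Finset U) (B : Fin m → Fin p → Finset U)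
      (C : Fin p → Fin n → Finset U) (D : Fin p → Finset U),
      (∀ j, S j = Finset.univ.biUnion (fun i => A i j) ∪
                  Finset.univ.biUnion (fun k => C k j)) ∧
      (∀ i, T i = Finset.univ.biUnion (fun j => A i j) ∪
                  Finset.univ.biUnion (fun k => B i k)) ∧
      (∀ k, X k = Finset.univ.biUnion (fun i => B i k) ∪
                  Finset.univ.biUnion (fun j => C k j) ∪ D k) := by
  constructor
  · intro h
    have hmem (a : U) : ((∃ j, a ∈ S j) ∨ ∃ k, a ∈ X k) ↔ ((∃ i, a ∈ T i) ∨ ∃ k, a ∈ X k) := by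
      simpa using Finset.ext_iff.mp h a
    refine ⟨fun i j => T i ∩ S j, fun i k => T i ∩ X k, fun k j => X k ∩ S j, X,
      fun j => ?_, fun i => ?_, fun k => ?_⟩
    · ext a
      have := hmem a
      simp only [Finset.mem_union, Finset.mem_biUnion, Finset.mem_univ, true_and,
        Finset.mem_inter]
      grind
    · ext a
      have := hmem a
      simp only [Finset.mem_union, Finset.mem_biUnion, Finset.mem_univ, true_and,
        Finset.mem_inter]
      grind
    · ext a
      simp only [Finset.mem_union, Finset.mem_biUnion, Finset.mem_univ, true_and,
        Finset.mem_inter]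
      grind
  · rintro ⟨A, B, C, D, hS, hT, hX⟩
    ext a
    have hSa (j) : a ∈ S j ↔ (∃ i, a ∈ A i j) ∨ ∃ k, a ∈ C k j := by simp [hS j]
    have hTa (i) : a ∈ T i ↔ (∃ j, a ∈ A i j) ∨ ∃ k, a ∈ B i k := by simp [hT i]
    have hXa (k) : a ∈ X k ↔ ((∃ i, a ∈ B i k) ∨ ∃ j, a ∈ C k j) ∨ a ∈ D k := by
      simp [hX k, or_assoc]
    simp only [Finset.mem_union, Finset.mem_biUnion, Finset.mem_univ, true_and]
    constructor
    · rintro (⟨j, hj⟩ | hk)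
      · rcases (hSa j).mp hj with ⟨i, hi⟩ | ⟨k, hk⟩
        · exact .inl ⟨i, (hTa i).mpr (.inl ⟨j, hi⟩)⟩
        · exact .inr ⟨k, (hXa k).mpr (.inl (.inr ⟨j, hk⟩))⟩
      · exact .inr hk
    · rintro (⟨i, hi⟩ | hk)
      · rcases (hTa i).mp hi with ⟨j, hj⟩ | ⟨k, hk⟩
        · exact .inl ⟨j, (hSa j).mpr (.inl ⟨i, hj⟩)⟩
        · exact .inr ⟨k, (hXa k).mpr (.inl (.inl ⟨i, hk⟩))⟩
      · exact .inr hk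
end
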